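/- For an ergodic dynamical system (X, T, μ) with X a compact metric space in ℝ^n, for every grid θ: for q ≤ 0 one has Δ_τ^±(θ,q) ≥ Δ_μ^±(θ,q) ≥ D_μ^±(q) and Δ_τ^±(θ,q) ≥ D_τ^±(q); and for q = 0, Δ_τ^±(θ,0) = Δ_μ^±(θ,0). -/

import Mathlib

open MeasureTheory Filter Set
open scoped ENNReal Topology NNReal

noncomputable section

/-- First return time of `x` to the set `A` under the map `T`;
by convention it is `0` if the orbit of `x` never returns to `A`. -/
def firstReturn {α : Type*} (T : α → α) (A : Set α) (x : α) : ℕ :=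
  sInf {k : ℕ | 0 < k ∧ T^[k] x ∈ A}

/-- Extended logarithm `ℝ≥0∞ → EReal`. -/
def elog (x : ℝ≥0∞) : EReal :=
  if x = 0 then ⊥ else if x = ⊤ then ⊤ else ((Real.log x.toReal : ℝ) : EReal)

section Generic

variable {α : Type*} [MeasurableSpace α] [PseudoMetricSpace α]

/-- The measure partition function `Γ_μ(ε,q)`. -/
def measPF (μ : Measure α) (ε q : ℝ) : ℝ≥0∞ :=
  ∫⁻ x, μ (Metric.ball x ε) ^ (q - 1) ∂μ

/-- The logarithmic measure partition function `Γ^l_μ(ε)`. -/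
def measPFlog (μ : Measure α) (ε : ℝ) : ℝ :=
  ∫ x, Real.log (μ (Metric.ball x ε)).toReal ∂μ

/-- The return time partition function `Γ_τ(ε,q)`. -/
def retPF (T : α → α) (μ : Measure α) (ε q : ℝ) : ℝ≥0∞ :=
  ∫⁻ x, (firstReturn T (Metric.ball x ε) x : ℝ≥0∞) ^ (1 - q) ∂μ

/-- The logarithmic return time partition function `Γ^l_τ(ε)`. -/
def retPFlog (T : α → α) (μ : Measure α) (ε : ℝ) : ℝ :=
  ∫ x, Real.log ((firstReturn T (Metric.ball x ε) x : ℝ))⁻¹ ∂μ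

/-- The scaling exponent `(1/(q-1)) · log F(ε) / log ε`. -/
def dimScale (F : ℝ → ℝ≥0∞) (q : ℝ) (ε : ℝ) : EReal :=
  ((((q - 1) * Real.log ε)⁻¹ : ℝ) : EReal) * elog (F ε)

/-- Upper generalized dimension obtained from a one-parameter family of partition
functions `F ε`, with the logarithmic convention at `q = 1`. -/
def dimPlus (F : ℝ → ℝ≥0∞) (Flog : ℝ → ℝ) (q : ℝ) : EReal :=
  if q = 1 then ((limsup (fun ε => Flog ε / Real.log ε) (𝓝[>] (0:ℝ)) : ℝ) : EReal)
  else limsup (dimScale F q) (𝓝[>] (0:ℝ))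

/-- Lower generalized dimension. -/
def dimMinus (F : ℝ → ℝ≥0∞) (Flog : ℝ → ℝ) (q : ℝ) : EReal :=
  if q = 1 then ((liminf (fun ε => Flog ε / Real.log ε) (𝓝[>] (0:ℝ)) : ℝ) : EReal)
  else liminf (dimScale F q) (𝓝[>] (0:ℝ))

/-- Generalized measure dimensions `D_μ^+(q)`. -/
def DmuPlus (μ : Measure α) (q : ℝ) : EReal :=
  dimPlus (fun ε => measPF μ ε q) (measPFlog μ) q

/-- Generalized measure dimensions `D_μ^-(q)`. -/
def DmuMinus (μ : Measure α) (q : ℝ) : EReal :=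
  dimMinus (fun ε => measPF μ ε q) (measPFlog μ) q

/-- Return time generalized dimensions `D_τ^+(q)`. -/
def DtauPlus (T : α → α) (μ : Measure α) (q : ℝ) : EReal :=
  dimPlus (fun ε => retPF T μ ε q) (retPFlog T μ) q

/-- Return time generalized dimensions `D_τ^-(q)`. -/
def DtauMinus (T : α → α) (μ : Measure α) (q : ℝ) : EReal :=
  dimMinus (fun ε => retPF T μ ε q) (retPFlog T μ) q

end Generic

/-- Euclidean space `ℝ^n`. -/
abbrev Euc (n : ℕ) := EuclideanSpace ℝ (Fin n)

/-- A grid in `ℝ^n` : a choice of origin and orientation, determining for every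
side length `ε` a partition of `ℝ^n` into half-open cubes of side `ε`. -/
structure Grid (n : ℕ) where
  origin : Euc n
  rot : Euc n ≃ₗᵢ[ℝ] Euc n

/-- Coordinates of a point w.r.t. a grid. -/
def Grid.coords {n : ℕ} (θ : Grid n) (x : Euc n) : Fin n → ℝ :=
  fun i => θ.rot.symm (x - θ.origin) i

/-- The cube `A_j` of side `ε` of the grid `θ`, indexed by `j : Fin n → ℤ`. -/
def Grid.box {n : ℕ} (θ : Grid n) (ε : ℝ) (j : Fin n → ℤ) : Set (Euc n) :=
  {x | ∀ i, (j i : ℝ) * ε ≤ θ.coords x i ∧ θ.coords x i < ((j i : ℝ) + 1) * ε}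

/-- The enlarged cube `Ā_j` of side `3ε` concentric with `A_j`. -/
def Grid.bigBox {n : ℕ} (θ : Grid n) (ε : ℝ) (j : Fin n → ℤ) : Set (Euc n) :=
  {x | ∀ i, ((j i : ℝ) - 1) * ε ≤ θ.coords x i ∧ θ.coords x i < ((j i : ℝ) + 2) * ε}

/-- Box measure partition function `Υ_μ(θ,ε,q) = Σ_{μ(A_j)>0} μ(A_j)^q`. -/
def boxMeasPF {n : ℕ} (μ : Measure (Euc n)) (θ : Grid n) (ε q : ℝ) : ℝ≥0∞ :=
  ∑' j : Fin n → ℤ, if μ (θ.box ε j) = 0 then 0 else μ (θ.box ε j) ^ q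

/-- Logarithmic box measure partition function `Υ^l_μ(θ,ε)`. -/
def boxMeasPFlog {n : ℕ} (μ : Measure (Euc n)) (θ : Grid n) (ε : ℝ) : ℝ :=
  ∑' j : Fin n → ℤ, (μ (θ.box ε j)).toReal * Real.log (μ (θ.box ε j)).toReal

/-- Return time box partition function `Υ_τ(θ,ε,q)`. -/
def boxRetPF {n : ℕ} (T : Euc n → Euc n) (μ : Measure (Euc n)) (θ : Grid n)
    (ε q : ℝ) : ℝ≥0∞ :=
  ∑' j : Fin n → ℤ, ∫⁻ x in θ.box ε j,
    (firstReturn T (θ.box ε j) x : ℝ≥0∞) ^ (1 - q) ∂μ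

/-- Logarithmic return time box partition function `Υ^l_τ(θ,ε)`. -/
def boxRetPFlog {n : ℕ} (T : Euc n → Euc n) (μ : Measure (Euc n)) (θ : Grid n)
    (ε : ℝ) : ℝ :=
  ∑' j : Fin n → ℤ, ∫ x in θ.box ε j,
    Real.log ((firstReturn T (θ.box ε j) x : ℝ))⁻¹ ∂μ

/-- Riedi's enhanced box partition function `Φ_μ(θ,ε,q)`. -/
def riediPF {n : ℕ} (μ : Measure (Euc n)) (θ : Grid n) (ε q : ℝ) : ℝ≥0∞ :=
  ∑' j : Fin n → ℤ, if μ (θ.box ε j) = 0 then 0 else μ (θ.bigBox ε j) ^ q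

/-- The enhanced box partition function `Ψ_μ(θ,ε,q) = Σ_{μ(A_j)>0} μ(A_j) μ(Ā_j)^{q-1}`. -/
def psiMeasPF {n : ℕ} (μ : Measure (Euc n)) (θ : Grid n) (ε q : ℝ) : ℝ≥0∞ :=
  ∑' j : Fin n → ℤ,
    if μ (θ.box ε j) = 0 then 0 else μ (θ.box ε j) * μ (θ.bigBox ε j) ^ (q - 1)

/-- The logarithmic enhanced box partition function `Ψ^l_μ(θ,ε)`. -/
def psiMeasPFlog {n : ℕ} (μ : Measure (Euc n)) (θ : Grid n) (ε : ℝ) : ℝ :=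
  ∑' j : Fin n → ℤ, (μ (θ.box ε j)).toReal * Real.log (μ (θ.bigBox ε j)).toReal

/-- The enhanced return time box partition function `Ψ_τ(θ,ε,q)`:
the integral is over `A_j` but the return is to the enlarged box `Ā_j`. -/
def psiRetPF {n : ℕ} (T : Euc n → Euc n) (μ : Measure (Euc n)) (θ : Grid n)
    (ε q : ℝ) : ℝ≥0∞ :=
  ∑' j : Fin n → ℤ, ∫⁻ x in θ.box ε j,
    (firstReturn T (θ.bigBox ε j) x : ℝ≥0∞) ^ (1 - q) ∂μ

/-- Box measure dimensions `Δ_μ^+(θ,q)`. -/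
def DeltaMuPlus {n : ℕ} (μ : Measure (Euc n)) (θ : Grid n) (q : ℝ) : EReal :=
  dimPlus (fun ε => boxMeasPF μ θ ε q) (boxMeasPFlog μ θ) q

/-- Box measure dimensions `Δ_μ^-(θ,q)`. -/
def DeltaMuMinus {n : ℕ} (μ : Measure (Euc n)) (θ : Grid n) (q : ℝ) : EReal :=
  dimMinus (fun ε => boxMeasPF μ θ ε q) (boxMeasPFlog μ θ) q

/-- Box return time dimensions `Δ_τ^+(θ,q)`. -/
def DeltaTauPlus {n : ℕ} (T : Euc n → Euc n) (μ : Measure (Euc n)) (θ : Grid n)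
    (q : ℝ) : EReal :=
  dimPlus (fun ε => boxRetPF T μ θ ε q) (boxRetPFlog T μ θ) q

/-- Box return time dimensions `Δ_τ^-(θ,q)`. -/
def DeltaTauMinus {n : ℕ} (T : Euc n → Euc n) (μ : Measure (Euc n)) (θ : Grid n)
    (q : ℝ) : EReal :=
  dimMinus (fun ε => boxRetPF T μ θ ε q) (boxRetPFlog T μ θ) q

end

section Scaling

theorem map_const_mul_nhdsGT_zero {c : ℝ} (hc : 0 < c) :
    map (fun x : ℝ => c * x) (𝓝[>] 0) = 𝓝[>] 0 := by
  conv_lhs => rw [← comap_mulLeft_nhdsGT_zero hc]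
  exact map_comap_of_surjective (mul_left_surjective₀ hc.ne') _

theorem elog_mono : Monotone elog := by
  intro a b hab
  unfold elog
  by_cases ha : a = 0
  · simp [ha]
  by_cases hb : b = ⊤
  · simp [hb]
  have hb0 : b ≠ 0 := fun h => ha (le_antisymm (h ▸ hab) zero_le)
  have ha' : a ≠ ⊤ := ne_top_of_le_ne_top hb hab
  simp only [ha, hb, hb0, ha', if_false]
  exact_mod_cast Real.log_le_log (ENNReal.toReal_pos ha ha') (ENNReal.toReal_mono hb hab)

theorem tendsto_log_div_log_const_mul {c : ℝ} (hc : 0 < c) :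
    Tendsto (fun ε => Real.log ε / Real.log (c * ε)) (𝓝[>] 0) (𝓝 1) := by
  have h1 : Tendsto (fun ε => Real.log (c * ε)) (𝓝[>] 0) atBot :=
    Real.tendsto_log_nhdsGT_zero.comp (map_const_mul_nhdsGT_zero hc).le
  have h2 : Tendsto (fun ε => 1 - Real.log c / Real.log (c * ε)) (𝓝[>] 0) (𝓝 (1 - 0)) :=
    tendsto_const_nhds.sub (tendsto_const_nhds.div_atBot h1)
  rw [sub_zero] at h2
  refine h2.congr' ?_
  filter_upwards [self_mem_nhdsWithin, h1.eventually_lt_atBot 0] with ε hε hlt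
  have : Real.log (c * ε) = Real.log c + Real.log ε := Real.log_mul hc.ne' (ne_of_gt hε)
  rw [eq_div_iff hlt.ne, sub_mul, div_mul_cancel₀ _ hlt.ne]
  linarith

/-- Rescaling the argument by a positive constant changes the scaling exponent by a factor
close to `1`. -/
theorem dimScale_const_mul_eventually_lt {F G : ℝ → ℝ≥0∞} {q c : ℝ} (hc : 0 < c) (hq : q ≤ 0)
    (hFG : ∀ ε > 0, F (c * ε) ≤ G ε) {a b : ℝ} (hab : a < b) :
    ∀ᶠ ε in 𝓝[>] (0 : ℝ), dimScale G q ε < a → dimScale F q (c * ε) ≤ b := by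
  have hr := tendsto_log_div_log_const_mul hc
  have hra : Tendsto (fun ε => Real.log ε / Real.log (c * ε) * a) (𝓝[>] 0) (𝓝 a) := by
    simpa using hr.mul_const a
  have h1 : Tendsto (fun ε => Real.log (c * ε)) (𝓝[>] 0) atBot :=
    Real.tendsto_log_nhdsGT_zero.comp (map_const_mul_nhdsGT_zero hc).le
  filter_upwards [self_mem_nhdsWithin, h1.eventually_lt_atBot 0,
    Real.tendsto_log_nhdsGT_zero.eventually_lt_atBot 0, hra.eventually_lt_const hab]
    with ε hε hl1 hl2 hlt hG
  have hpos : 0 ≤ ((q - 1) * Real.log (c * ε))⁻¹ :=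
    inv_nonneg.2 (mul_nonneg_of_nonpos_of_nonpos (by linarith) hl1.le)
  have hrpos : 0 ≤ Real.log ε / Real.log (c * ε) := div_nonneg_of_nonpos hl2.le hl1.le
  have hfac : ((q - 1) * Real.log (c * ε))⁻¹ =
      Real.log ε / Real.log (c * ε) * ((q - 1) * Real.log ε)⁻¹ := by
    have : q - 1 ≠ 0 := by linarith
    have := hl1.ne
    have := hl2.ne
    field_simp
  calc dimScale F q (c * ε)
      ≤ ((((q - 1) * Real.log (c * ε))⁻¹ : ℝ) : EReal) * elog (G ε) :=
        mul_le_mul_of_nonneg_left (elog_mono (hFG ε hε)) (by exact_mod_cast hpos)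
    _ = ((Real.log ε / Real.log (c * ε) : ℝ) : EReal) * dimScale G q ε := by
        rw [hfac, EReal.coe_mul, mul_assoc, dimScale]
    _ ≤ ((Real.log ε / Real.log (c * ε) : ℝ) : EReal) * a :=
        mul_le_mul_of_nonneg_left hG.le (by exact_mod_cast hrpos)
    _ ≤ b := by exact_mod_cast hlt.le

theorem dimPlus_le_of_const_mul_le {F G : ℝ → ℝ≥0∞} (Fl Gl : ℝ → ℝ) {q c : ℝ} (hc : 0 < c)
    (hq : q ≤ 0) (hFG : ∀ ε > 0, F (c * ε) ≤ G ε) : dimPlus F Fl q ≤ dimPlus G Gl q := by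
  have hq1 : q ≠ 1 := by linarith
  simp only [dimPlus, hq1, if_false]
  refine EReal.le_of_forall_lt_iff_le.1 fun b hb => ?_
  obtain ⟨a, ha, hab⟩ := EReal.lt_iff_exists_real_btwn.1 hb
  rw [← map_const_mul_nhdsGT_zero hc]
  change limsup (fun ε => dimScale F q (c * ε)) (𝓝[>] 0) ≤ b
  refine limsup_le_of_le (by isBoundedDefault) ?_
  filter_upwards [dimScale_const_mul_eventually_lt hc hq hFG (EReal.coe_lt_coe_iff.1 hab),
    eventually_lt_of_limsup_lt ha] with ε h1 h2 using h1 h2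

theorem dimMinus_le_of_const_mul_le {F G : ℝ → ℝ≥0∞} (Fl Gl : ℝ → ℝ) {q c : ℝ} (hc : 0 < c)
    (hq : q ≤ 0) (hFG : ∀ ε > 0, F (c * ε) ≤ G ε) : dimMinus F Fl q ≤ dimMinus G Gl q := by
  have hq1 : q ≠ 1 := by linarith
  simp only [dimMinus, hq1, if_false]
  refine EReal.le_of_forall_lt_iff_le.1 fun b hb => ?_
  obtain ⟨a, ha, hab⟩ := EReal.lt_iff_exists_real_btwn.1 hb
  rw [← map_const_mul_nhdsGT_zero hc]
  change liminf (fun ε => dimScale F q (c * ε)) (𝓝[>] 0) ≤ b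
  refine liminf_le_of_frequently_le ?_ (by isBoundedDefault)
  exact (frequently_lt_of_liminf_lt (by isBoundedDefault) ha).mp
    (dimScale_const_mul_eventually_lt hc hq hFG (EReal.coe_lt_coe_iff.1 hab))

end Scaling

section Return

variable {α : Type*}

theorem lt_firstReturn_iff {T : α → α} {A : Set α} {x : α} (h : ∃ k, 0 < k ∧ T^[k] x ∈ A)
    (k : ℕ) : k < firstReturn T A x ↔ ∀ i < k, T^[i] (T x) ∉ A := by
  have hmem : firstReturn T A x ∈ {k : ℕ | 0 < k ∧ T^[k] x ∈ A} := Nat.sInf_mem h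
  constructor
  · intro hk i hi hiA
    have : firstReturn T A x ≤ i + 1 := Nat.sInf_le ⟨i.succ_pos, hiA⟩
    omega
  · intro hk
    by_contra! hle
    obtain ⟨hpos, hA⟩ := hmem
    obtain ⟨m, hm⟩ := Nat.exists_eq_succ_of_ne_zero hpos.ne'
    rw [hm] at hA
    exact hk m (by omega) hA

theorem firstReturn_anti {T : α → α} {A B : Set α} {x : α} (h : ∃ k, 0 < k ∧ T^[k] x ∈ A)
    (hAB : A ⊆ B) : firstReturn T B x ≤ firstReturn T A x := by
  have hmem : firstReturn T A x ∈ {k : ℕ | 0 < k ∧ T^[k] x ∈ A} := Nat.sInf_mem h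
  exact Nat.sInf_le ⟨hmem.1, hAB hmem.2⟩

theorem tsum_ite_lt_natCast (m : ℕ) : ∑' k, (if k < m then (1 : ℝ≥0∞) else 0) = m := by
  rw [tsum_eq_sum (s := Finset.range m)]
  · rw [Finset.sum_congr rfl (g := fun _ => 1)]
    · simp
    · intro i hi
      simp [Finset.mem_range.1 hi]
  · simp

/-- The points that do not visit `A` during the first `k` instants. -/
def avoidSet (T : α → α) (A : Set α) (k : ℕ) : Set α := {x | ∀ i < k, T^[i] x ∉ A}

theorem avoidSet_succ (T : α → α) (A : Set α) (k : ℕ) :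
    avoidSet T A (k + 1) = (T ⁻¹' avoidSet T A k) \ A := by
  ext x
  simp only [avoidSet, mem_ofPred_eq, Set.mem_sdiff, mem_preimage]
  constructor
  · exact fun h => ⟨fun i hi => h (i + 1) (by omega), h 0 (by omega)⟩
  · rintro ⟨h1, h2⟩ (_ | i) hi
    · exact h2
    · exact h1 i (by omega)

variable [MeasurableSpace α]

theorem ae_exists_return {T : α → α} {μ : Measure α} [IsFiniteMeasure μ]
    (hT : MeasurePreserving T μ μ) {A : Set α} (hA : MeasurableSet A) :
    ∀ᵐ x ∂μ, x ∈ A → ∃ k, 0 < k ∧ T^[k] x ∈ A := by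
  filter_upwards [hT.conservative.ae_mem_imp_frequently_image_mem hA.nullMeasurableSet]
    with x hx hxA
  obtain ⟨k, hk, hkA⟩ := ((hx hxA).and_eventually (eventually_gt_atTop 0)).exists
  exact ⟨k, hkA, hk⟩

theorem measurableSet_avoidSet {T : α → α} (hT : Measurable T) {A : Set α}
    (hA : MeasurableSet A) (k : ℕ) : MeasurableSet (avoidSet T A k) := by
  have : avoidSet T A k = ⋂ i, ⋂ (_ : i < k), (T^[i] ⁻¹' A)ᶜ := by
    ext x
    simp [avoidSet]
  rw [this]
  exact MeasurableSet.iInter fun i => MeasurableSet.iInter fun _ => (hT.iterate i hA).compl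

theorem Ergodic.measure_iInter_avoidSet {T : α → α} {μ : Measure α} [IsProbabilityMeasure μ]
    (hT : Ergodic T μ) {A : Set α} (hA : MeasurableSet A) (hA0 : μ A ≠ 0) :
    μ (⋂ k, avoidSet T A k) = 0 := by
  have hN : (⋂ k, avoidSet T A k) = (⋃ k, T^[k] ⁻¹' A)ᶜ := by
    ext x
    simp only [avoidSet, mem_iInter, mem_ofPred_eq, mem_compl_iff, mem_iUnion, mem_preimage,
      not_exists]
    exact ⟨fun h i => h (i + 1) i (by omega), fun h _ i _ => h i⟩
  have hm : MeasurableSet (⋃ k, T^[k] ⁻¹' A) :=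
    MeasurableSet.iUnion fun k => hT.measurable.iterate k hA
  have hsub : T ⁻¹' (⋃ k, T^[k] ⁻¹' A) ⊆ ⋃ k, T^[k] ⁻¹' A := by
    intro x hx
    obtain ⟨k, hk⟩ := mem_iUnion.1 hx
    exact mem_iUnion.2 ⟨k + 1, hk⟩
  rcases hT.ae_empty_or_univ_of_preimage_ae_le hm.nullMeasurableSet hsub.eventuallyLE with h | h
  · exfalso
    apply hA0
    have hle : μ A ≤ μ (⋃ k, T^[k] ⁻¹' A) :=
      measure_mono fun x hx => mem_iUnion.2 ⟨0, hx⟩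
    rw [measure_congr h, measure_empty] at hle
    exact le_antisymm hle zero_le
  · rw [hN, measure_congr h.compl, compl_univ, measure_empty]

theorem Ergodic.tsum_measure_inter_preimage_avoidSet {T : α → α} {μ : Measure α}
    [IsProbabilityMeasure μ] (hT : Ergodic T μ) {A : Set α} (hA : MeasurableSet A)
    (hA0 : μ A ≠ 0) : ∑' k, μ (A ∩ T ⁻¹' avoidSet T A k) = 1 := by
  have hE := measurableSet_avoidSet hT.measurable hA
  have hstep : ∀ k, μ (A ∩ T ⁻¹' avoidSet T A k) + μ (avoidSet T A (k + 1)) =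
      μ (avoidSet T A k) := by
    intro k
    rw [avoidSet_succ, inter_comm, measure_inter_add_sdiff _ hA,
      hT.measure_preimage (hE k).nullMeasurableSet]
  have hsum : ∀ N, ∑ k ∈ Finset.range N, μ (A ∩ T ⁻¹' avoidSet T A k) + μ (avoidSet T A N) =
      1 := by
    intro N
    induction N with
    | zero => simp [avoidSet]
    | succ N ih => rw [Finset.sum_range_succ, add_assoc, hstep, ih]
  have hlim : Tendsto (fun k => μ (avoidSet T A k)) atTop (𝓝 0) := by
    rw [← hT.measure_iInter_avoidSet hA hA0]
    refine tendsto_measure_iInter_atTop (fun k => (hE k).nullMeasurableSet) ?_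
      ⟨0, measure_ne_top _ _⟩
    exact fun k l hkl x hx i hi => hx i (hi.trans_le hkl)
  have h1 := (ENNReal.tendsto_nat_tsum fun k => μ (A ∩ T ⁻¹' avoidSet T A k)).add hlim
  simp only [hsum, add_zero] at h1
  exact tendsto_nhds_unique h1 tendsto_const_nhds

theorem firstReturn_ae_eq_tsum {T : α → α} {μ : Measure α} [IsFiniteMeasure μ]
    (hT : MeasurePreserving T μ μ) {A : Set α} (hA : MeasurableSet A) :
    (fun x => (firstReturn T A x : ℝ≥0∞)) =ᵐ[μ.restrict A]
      fun x => ∑' k, (T ⁻¹' avoidSet T A k).indicator (fun _ => 1) x := by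
  refine (ae_restrict_iff' hA).2 ?_
  filter_upwards [ae_exists_return hT hA] with x hx hxA
  classical
  rw [← tsum_ite_lt_natCast]
  refine tsum_congr fun k => ?_
  rw [indicator_apply]
  exact if_congr (lt_firstReturn_iff (hx hxA) k) rfl rfl

theorem aemeasurable_firstReturn {T : α → α} {μ : Measure α} [IsFiniteMeasure μ]
    (hT : MeasurePreserving T μ μ) {A : Set α} (hA : MeasurableSet A) :
    AEMeasurable (fun x => (firstReturn T A x : ℝ≥0∞)) (μ.restrict A) :=
  ⟨_, Measurable.tsum fun k => measurable_const.indicator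
    (hT.measurable (measurableSet_avoidSet hT.measurable hA k)), firstReturn_ae_eq_tsum hT hA⟩

/-- Kac lemma: the first return time to a set of positive measure has integral one over it. -/
theorem Ergodic.setLIntegral_firstReturn {T : α → α} {μ : Measure α} [IsProbabilityMeasure μ]
    (hT : Ergodic T μ) {A : Set α} (hA : MeasurableSet A) (hA0 : μ A ≠ 0) :
    ∫⁻ x in A, (firstReturn T A x : ℝ≥0∞) ∂μ = 1 := by
  have hE k := hT.measurable (measurableSet_avoidSet hT.measurable hA k)
  rw [lintegral_congr_ae (firstReturn_ae_eq_tsum hT.toMeasurePreserving hA),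
    lintegral_tsum fun k => (measurable_const.indicator (hE k)).aemeasurable]
  refine (tsum_congr fun k => ?_).trans (hT.tsum_measure_inter_preimage_avoidSet hA hA0)
  rw [lintegral_indicator (hE k), setLIntegral_const, Measure.restrict_apply (hE k), inter_comm]
  exact one_mul _

theorem Ergodic.measure_rpow_le_setLIntegral_firstReturn {T : α → α} {μ : Measure α}
    [IsProbabilityMeasure μ] (hT : Ergodic T μ) {A : Set α} (hA : MeasurableSet A)
    (hA0 : μ A ≠ 0) {q : ℝ} (hq : q ≤ 0) :
    μ A ^ q ≤ ∫⁻ x in A, (firstReturn T A x : ℝ≥0∞) ^ (1 - q) ∂μ := by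
  rcases hq.eq_or_lt with rfl | hq
  · simp [hT.setLIntegral_firstReturn hA hA0]
  have hp : (1 - q).HolderConjugate (1 - q).conjExponent :=
    Real.HolderConjugate.conjExponent (by linarith)
  have hp0 : 0 < 1 - q := by linarith
  have hH := ENNReal.lintegral_mul_le_Lp_mul_Lq (μ.restrict A) hp
    (aemeasurable_firstReturn hT.toMeasurePreserving hA) (aemeasurable_const (b := 1))
  simp only [Pi.mul_apply, mul_one, ENNReal.one_rpow, setLIntegral_const, one_mul,
    hT.setLIntegral_firstReturn hA hA0] at hH
  have hH' := ENNReal.rpow_le_rpow hH hp0.le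
  have he : 1 / (1 - q).conjExponent * (1 - q) = -q := by
    rw [Real.conjExponent]
    field_simp
    ring
  rw [ENNReal.one_rpow, ENNReal.mul_rpow_of_nonneg _ _ hp0.le, ← ENNReal.rpow_mul,
    ← ENNReal.rpow_mul, he, one_div_mul_cancel hp0.ne', ENNReal.rpow_one] at hH'
  calc μ A ^ q = μ A ^ q * 1 := (mul_one _).symm
    _ ≤ μ A ^ q * ((∫⁻ x in A, (firstReturn T A x : ℝ≥0∞) ^ (1 - q) ∂μ) * μ A ^ (-q)) := by
      gcongr
    _ = (∫⁻ x in A, (firstReturn T A x : ℝ≥0∞) ^ (1 - q) ∂μ) * (μ A ^ q * μ A ^ (-q)) := by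
      ring
    _ = ∫⁻ x in A, (firstReturn T A x : ℝ≥0∞) ^ (1 - q) ∂μ := by
      rw [← ENNReal.rpow_add _ _ hA0 (measure_ne_top _ _), add_neg_cancel, ENNReal.rpow_zero,
        mul_one]

end Return

section Boxes

variable {n : ℕ}

theorem Grid.measurableSet_box (θ : Grid n) (ε : ℝ) (j : Fin n → ℤ) :
    MeasurableSet (θ.box ε j) := by
  have hc : ∀ i, Measurable fun x => θ.coords x i := by
    intro i
    have : Continuous fun x => θ.coords x i := by
      unfold Grid.coords
      fun_prop
    exact this.measurable
  simp only [Grid.box, ofPred_forall]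
  exact MeasurableSet.iInter fun i =>
    (measurableSet_le measurable_const (hc i)).inter (measurableSet_lt (hc i) measurable_const)

theorem Grid.iUnion_box (θ : Grid n) {ε : ℝ} (hε : 0 < ε) : ⋃ j, θ.box ε j = univ := by
  refine eq_univ_of_forall fun x => mem_iUnion.2 ⟨fun i => ⌊θ.coords x i / ε⌋, fun i => ?_⟩
  exact ⟨(le_div_iff₀ hε).1 (Int.floor_le _), (div_lt_iff₀ hε).1 (Int.lt_floor_add_one _)⟩

theorem Grid.box_subset_ball (θ : Grid n) {ε : ℝ} (hε : 0 < ε) {j : Fin n → ℤ} {x : Euc n}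
    (hx : x ∈ θ.box ε j) : θ.box ε j ⊆ Metric.ball x ((n + 1) * ε) := by
  intro y hy
  have h1 : dist y x = ‖θ.rot.symm (y - θ.origin) - θ.rot.symm (x - θ.origin)‖ := by
    rw [← map_sub, LinearIsometryEquiv.norm_map, sub_sub_sub_cancel_right, dist_eq_norm]
  rw [Metric.mem_ball, h1, EuclideanSpace.norm_eq, Real.sqrt_lt' (by positivity)]
  have h2 : ∀ i ∈ Finset.univ,
      ‖(θ.rot.symm (y - θ.origin) - θ.rot.symm (x - θ.origin)) i‖ ^ 2 ≤ ε ^ 2 := by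
    intro i _
    have hxi := hx i
    have hyi := hy i
    simp only [Grid.coords] at hxi hyi
    rw [PiLp.sub_apply, Real.norm_eq_abs, sq_abs]
    apply sq_le_sq'
    all_goals nlinarith
  calc _ ≤ ∑ _i : Fin n, ε ^ 2 := Finset.sum_le_sum h2
    _ = n * ε ^ 2 := by simp
    _ < ((n + 1) * ε) ^ 2 := by
      have : 0 < ε ^ 2 := by positivity
      have : (0 : ℝ) ≤ n := n.cast_nonneg
      nlinarith [mul_nonneg this (by positivity : 0 ≤ ε ^ 2),
        mul_nonneg (mul_nonneg this this) (by positivity : 0 ≤ ε ^ 2)]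

theorem Grid.lintegral_le_tsum_box (θ : Grid n) {ε : ℝ} (hε : 0 < ε) (μ : Measure (Euc n))
    (f : Euc n → ℝ≥0∞) : ∫⁻ x, f x ∂μ ≤ ∑' j, ∫⁻ x in θ.box ε j, f x ∂μ := by
  rw [← setLIntegral_univ, ← θ.iUnion_box hε]
  exact lintegral_iUnion_le _ _

variable {T : Euc n → Euc n} {μ : Measure (Euc n)} [IsProbabilityMeasure μ]

theorem measPF_le_boxMeasPF (μ : Measure (Euc n)) [IsProbabilityMeasure μ] (θ : Grid n)
    {ε q : ℝ} (hε : 0 < ε) (hq : q ≤ 0) :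
    measPF μ ((n + 1) * ε) q ≤ boxMeasPF μ θ ε q := by
  refine (θ.lintegral_le_tsum_box hε μ _).trans (ENNReal.tsum_le_tsum fun j => ?_)
  split_ifs with h
  · rw [Measure.restrict_zero_set h, lintegral_zero_measure]
  calc ∫⁻ x in θ.box ε j, μ (Metric.ball x ((n + 1) * ε)) ^ (q - 1) ∂μ
      ≤ ∫⁻ _ in θ.box ε j, μ (θ.box ε j) ^ (q - 1) ∂μ :=
        setLIntegral_mono' (θ.measurableSet_box ε j) fun x hx => by
          rw [← neg_sub 1 q, ENNReal.rpow_neg, ENNReal.rpow_neg]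
          exact ENNReal.inv_le_inv.2 <|
            ENNReal.rpow_le_rpow (measure_mono (θ.box_subset_ball hε hx)) (by linarith)
    _ = μ (θ.box ε j) ^ q := by
      rw [setLIntegral_const]
      conv_lhs => rw [← ENNReal.rpow_one (μ (θ.box ε j)), ← ENNReal.rpow_mul, one_mul]
      rw [← ENNReal.rpow_add _ _ h (measure_ne_top _ _), sub_add_cancel]

theorem retPF_le_boxRetPF (hT : MeasurePreserving T μ μ) (θ : Grid n)
    {ε q : ℝ} (hε : 0 < ε) (hq : q ≤ 0) :
    retPF T μ ((n + 1) * ε) q ≤ boxRetPF T μ θ ε q := by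
  refine (θ.lintegral_le_tsum_box hε μ _).trans (ENNReal.tsum_le_tsum fun j => ?_)
  refine setLIntegral_mono_ae' (θ.measurableSet_box ε j) ?_
  filter_upwards [ae_exists_return hT (θ.measurableSet_box ε j)] with x hx hxA
  refine ENNReal.rpow_le_rpow ?_ (by linarith)
  exact_mod_cast firstReturn_anti (hx hxA) (θ.box_subset_ball hε hxA)

theorem boxMeasPF_le_boxRetPF (hT : Ergodic T μ) (θ : Grid n) (ε : ℝ) {q : ℝ} (hq : q ≤ 0) :
    boxMeasPF μ θ ε q ≤ boxRetPF T μ θ ε q := by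
  refine ENNReal.tsum_le_tsum fun j => ?_
  split_ifs with h
  · exact zero_le
  · exact hT.measure_rpow_le_setLIntegral_firstReturn (θ.measurableSet_box ε j) h hq

theorem boxRetPF_zero (hT : Ergodic T μ) (θ : Grid n) (ε : ℝ) :
    boxRetPF T μ θ ε 0 = boxMeasPF μ θ ε 0 := by
  refine tsum_congr fun j => ?_
  split_ifs with h
  · rw [Measure.restrict_zero_set h, lintegral_zero_measure]
  · simp [hT.setLIntegral_firstReturn (θ.measurableSet_box ε j) h]

end Boxes

/-- For an ergodic dynamical system, for every grid `θ` and `q ≤ 0`: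
`Δ_τ^±(θ,q) ≥ Δ_μ^±(θ,q) ≥ D_μ^±(q)` and `Δ_τ^±(θ,q) ≥ D_τ^±(q)`; moreover for `q = 0`,
`Δ_τ^±(θ,0) = Δ_μ^±(θ,0)`. -/
theorem dimension_chain_nonpositive_q {n : ℕ} (T : Euc n → Euc n)
    (μ : Measure (Euc n)) [IsProbabilityMeasure μ] (X : Set (Euc n))
    (hXc : IsCompact X) (hX1 : μ X = 1) (hTX : Set.MapsTo T X X)
    (hErg : Ergodic T μ) :
    (∀ (θ : Grid n) (q : ℝ), q ≤ 0 →
      (DeltaMuPlus μ θ q ≤ DeltaTauPlus T μ θ q ∧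
        DmuPlus μ q ≤ DeltaMuPlus μ θ q ∧
        DtauPlus T μ q ≤ DeltaTauPlus T μ θ q) ∧
      (DeltaMuMinus μ θ q ≤ DeltaTauMinus T μ θ q ∧
        DmuMinus μ q ≤ DeltaMuMinus μ θ q ∧
        DtauMinus T μ q ≤ DeltaTauMinus T μ θ q)) ∧
    (∀ θ : Grid n,
      DeltaTauPlus T μ θ 0 = DeltaMuPlus μ θ 0 ∧
        DeltaTauMinus T μ θ 0 = DeltaMuMinus μ θ 0) := by
  have hc : (0 : ℝ) < n + 1 := by positivity
  refine ⟨fun θ q hq => ⟨⟨?_, ?_, ?_⟩, ?_, ?_, ?_⟩, fun θ => ⟨?_, ?_⟩⟩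
  · exact dimPlus_le_of_const_mul_le _ _ one_pos hq fun ε _ => by
      simpa using boxMeasPF_le_boxRetPF hErg θ ε hq
  · exact dimPlus_le_of_const_mul_le _ _ hc hq fun ε hε => measPF_le_boxMeasPF μ θ hε hq
  · exact dimPlus_le_of_const_mul_le _ _ hc hq fun ε hε =>
      retPF_le_boxRetPF hErg.toMeasurePreserving θ hε hq
  · exact dimMinus_le_of_const_mul_le _ _ one_pos hq fun ε _ => by
      simpa using boxMeasPF_le_boxRetPF hErg θ ε hq
  · exact dimMinus_le_of_const_mul_le _ _ hc hq fun ε hε => measPF_le_boxMeasPF μ θ hε hq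
  · exact dimMinus_le_of_const_mul_le _ _ hc hq fun ε hε =>
      retPF_le_boxRetPF hErg.toMeasurePreserving θ hε hq
  · simp [DeltaTauPlus, DeltaMuPlus, dimPlus, boxRetPF_zero hErg]
  · simp [DeltaTauMinus, DeltaMuMinus, dimMinus, boxRetPF_zero hErg]
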